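/- (Polynomial Koszul decomposition, d = 3.) For every integer m ≥ 0, the space of polynomial vector fields on ℝ³ of total degree at most m decomposes as a direct sum [P_m]³ = ∇P_{m+1} ⊕ κ([P_{m−1}]³), where ∇P_{m+1} = {∇θ : θ a polynomial of degree ≤ m+1} and κ([P_{m−1}]³) = {x × a(x) : a a polynomial vector field of degree ≤ m−1}; i.e., every polynomial vector field g of degree ≤ m can be written as g = ∇θ + x × a with deg θ ≤ m+1 and deg a ≤ m−1, and the two summands intersect only in 0. -/

import Mathlib

noncomputable section
open MvPolynomial

/-- Degree bound with integer degree: negative degree means the zero polynomial. -/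
def degLEI {n : ℕ} (k : ℤ) (p : MvPolynomial (Fin n) ℝ) : Prop :=
  if k < 0 then p = 0 else p.totalDegree ≤ k.toNat

/-- The polynomial cross product `x × a(x)` (three-dimensional Koszul operator). -/
def crossP (a : Fin 3 → MvPolynomial (Fin 3) ℝ) : Fin 3 → MvPolynomial (Fin 3) ℝ :=
  ![X 1 * a 2 - X 2 * a 1, X 2 * a 0 - X 0 * a 2, X 0 * a 1 - X 1 * a 0]

theorem kz_coeff_euler (p : MvPolynomial (Fin 3) ℝ) (s : Fin 3 →₀ ℕ) :
    coeff s (∑ i, X i * pderiv i p) = ((∑ i, s i : ℕ) : ℝ) * coeff s p := by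
  induction p using MvPolynomial.induction_on' with
  | monomial u a =>
    simp_rw [X_mul_pderiv_monomial, ← Finset.sum_smul, coeff_smul, coeff_monomial]
    split_ifs with h
    · subst h; simp
    · simp
  | add p q hp hq =>
    simp only [map_add, mul_add, Finset.sum_add_distrib, coeff_add] at *
    rw [hp, hq]

theorem kz_euler_zero (p : MvPolynomial (Fin 3) ℝ) (h : ∑ i, X i * pderiv i p = 0) (i : Fin 3) :
    pderiv i p = 0 := by
  ext s
  rw [coeff_pderiv, coeff_zero]
  have h1 := kz_coeff_euler p (s + Finsupp.single i 1)
  rw [h, coeff_zero] at h1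
  rcases mul_eq_zero.1 h1.symm with h2 | h2
  · exfalso
    have h3 : ∑ j, (s + Finsupp.single i 1 : Fin 3 →₀ ℕ) j = 0 := by exact_mod_cast h2
    have h4 := (Finset.sum_eq_zero_iff.1 h3) i (Finset.mem_univ i)
    simp at h4
  · rw [h2, zero_mul]

theorem kz_exists (m : ℕ) (g : MvPolynomial (Fin 3) ℝ) (hg : g.totalDegree ≤ m) :
    ∃ h : MvPolynomial (Fin 3) ℝ, h.totalDegree ≤ m ∧ g = h + ∑ i, X i * pderiv i h := by
  refine ⟨∑ s ∈ g.support, monomial s (coeff s g / (((∑ i, s i : ℕ) : ℝ) + 1)), ?_, ?_⟩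
  · refine totalDegree_finsetSum_le fun s hs => ?_
    exact (totalDegree_monomial_le _ _).trans ((le_totalDegree hs).trans hg)
  · ext s
    rw [coeff_add, kz_coeff_euler]
    simp only [coeff_sum, coeff_monomial, Finset.sum_ite_eq']
    split_ifs with h
    · have : (((∑ i, s i : ℕ) : ℝ) + 1) ≠ 0 := by positivity
      field_simp
      ring
    · simpa using h

theorem kz_degLEI (m : ℕ) (p : MvPolynomial (Fin 3) ℝ) (hp : p.totalDegree ≤ m) (i : Fin 3) :
    degLEI ((m : ℤ) - 1) (pderiv i p) := by
  unfold degLEI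
  split_ifs with h
  · have hm : p.totalDegree = 0 := by omega
    rw [totalDegree_eq_zero_iff_eq_C.1 hm, pderiv_C]
  · refine Finset.sup_le ?_
    intro s hs
    rw [mem_support_iff, coeff_pderiv] at hs
    have h1 : s + Finsupp.single i 1 ∈ p.support := mem_support_iff.2 (left_ne_zero_of_mul hs)
    have h2 := (le_totalDegree h1).trans hp
    rw [Finsupp.sum_add_index' (by simp) (by simp), Finsupp.sum_single_index rfl] at h2
    omega

theorem kz_degLEI_sub (k : ℤ) (p q : MvPolynomial (Fin 3) ℝ) (hp : degLEI k p) (hq : degLEI k q) :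
    degLEI k (p - q) := by
  unfold degLEI at *
  split_ifs at * with h
  · rw [hp, hq, sub_zero]
  · exact (totalDegree_sub p q).trans (max_le hp hq)

/-- polynomial Koszul decomposition, d = 3.
For every `m ≥ 0`, `[P_m]³ = ∇P_{m+1} ⊕ κ([P_{m−1}]³)`: every polynomial vector field
`g` of degree ≤ m can be written as `g = ∇θ + x × a` with `deg θ ≤ m+1` and
`deg a ≤ m−1` (with `P_{−1} = {0}`), and the two summands intersect only in `0`. -/
theorem koszul_decomposition_dim3 (m : ℕ) :
    (∀ g : Fin 3 → MvPolynomial (Fin 3) ℝ, (∀ i, (g i).totalDegree ≤ m) →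
      ∃ (θ : MvPolynomial (Fin 3) ℝ) (a : Fin 3 → MvPolynomial (Fin 3) ℝ),
        θ.totalDegree ≤ m + 1 ∧ (∀ i, degLEI ((m : ℤ) - 1) (a i)) ∧
        ∀ i, g i = pderiv i θ + crossP a i) ∧
    (∀ (θ : MvPolynomial (Fin 3) ℝ) (a : Fin 3 → MvPolynomial (Fin 3) ℝ),
      θ.totalDegree ≤ m + 1 → (∀ i, degLEI ((m : ℤ) - 1) (a i)) →
      (∀ i, pderiv i θ = crossP a i) →
      ∀ i, pderiv i θ = 0 ∧ crossP a i = 0) := by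
  constructor
  · intro g hg
    choose h hd hE using fun i => kz_exists m (g i) (hg i)
    refine ⟨∑ i, X i * h i, ![pderiv 2 (h 1) - pderiv 1 (h 2), pderiv 0 (h 2) - pderiv 2 (h 0),
      pderiv 1 (h 0) - pderiv 0 (h 1)], ?_, ?_, ?_⟩
    · refine totalDegree_finsetSum_le fun i _ => ?_
      refine (totalDegree_mul _ _).trans ?_
      rw [totalDegree_X]
      have := hd i
      omega
    · intro i
      fin_cases i <;> exact kz_degLEI_sub _ _ _ (kz_degLEI m _ (hd _) _) (kz_degLEI m _ (hd _) _)
    · intro i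
      rw [hE i]
      fin_cases i <;>
      · simp [crossP, Fin.sum_univ_three, pderiv_mul, pderiv_X, Pi.single_apply]
        ring
  · intro θ a _ _ h i
    have h0 : ∑ i, X i * pderiv i θ = 0 := by
      simp_rw [h]
      simp [crossP, Fin.sum_univ_three]
      ring
    have h1 := kz_euler_zero θ h0 i
    exact ⟨h1, by rw [← h i, h1]⟩

end
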